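/- Let b ≥ 2 be an integer and λ ∈ (1/α, 1] for an integer α ≥ 2. Then the sum over all positive integers k of b^{−λ μ_α(k)} is finite and equals A_{α,λ} = ∑_{τ=1}^{α−1} ∏_{i=1}^{τ} (b−1)/(b^{λ i} − 1) + ((b^{λα} − 1)/(b^{λα} − b)) ∏_{i=1}^{α} (b−1)/(b^{λ i} − 1). -/

import Mathlib

/-- The Dick weight `μ_α(k)`: the sum of the positions (`c_i`, counting from 1)
of the `min(α, v)` most significant nonzero base-`b` digits of `k`;
`μ_α(0) = 0`. -/
def dickWeight (b α k : ℕ) : ℕ :=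
  (((((List.range (Nat.digits b k).length).filter
      (fun i => (Nat.digits b k).getD i 0 ≠ 0)).reverse).take α).map (· + 1)).sum

open Filter Topology

/-- The increasing list of the (zero-based) positions of the nonzero base-`b` digits of `k`. -/
def digitPositions (b k : ℕ) : List ℕ :=
  (List.range (Nat.digits b k).length).filter (fun i => (Nat.digits b k).getD i 0 ≠ 0)

theorem digitPositions_zero (b : ℕ) : digitPositions b 0 = [] := by
  simp [digitPositions]

theorem dickWeight_eq (b α k : ℕ) :
    dickWeight b α k = (((digitPositions b k).reverse.take α).map (· + 1)).sum := rfl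

theorem digitPositions_mul_add {b : ℕ} (hb : 2 ≤ b) (q : ℕ) {r : ℕ} (hr : r < b) :
    digitPositions b (b * q + r) =
      (if r = 0 then [] else [0]) ++ (digitPositions b q).map (· + 1) := by
  by_cases h : r ≠ 0 ∨ q ≠ 0
  · have hd : Nat.digits b (b * q + r) = r :: Nat.digits b q := by
      rw [add_comm]
      exact Nat.digits_add b hb r q hr h
    rw [digitPositions, hd]
    by_cases h0 : r = 0 <;>
      simp [digitPositions, List.range_succ_eq_map, List.filter_map, h0, Function.comp_def]
  · push Not at h
    obtain ⟨rfl, rfl⟩ := h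
    simp [digitPositions]

theorem length_digitPositions_mul_add {b : ℕ} (hb : 2 ≤ b) (q : ℕ) {r : ℕ} (hr : r < b) :
    (digitPositions b (b * q + r)).length =
      (digitPositions b q).length + if r = 0 then 0 else 1 := by
  rw [digitPositions_mul_add hb q hr]
  split_ifs <;> simp

theorem List.sum_map_add_one (L : List ℕ) : (L.map (· + 1)).sum = L.sum + L.length := by
  induction L with
  | nil => rfl
  | cons a L ih => simp only [List.map_cons, List.sum_cons, List.length_cons, ih]; ring

theorem dickWeight_mul_add {b : ℕ} (hb : 2 ≤ b) (α q : ℕ) {r : ℕ} (hr : r < b) :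
    dickWeight b α (b * q + r) =
      dickWeight b α q + min (digitPositions b q).length α +
        if r ≠ 0 ∧ (digitPositions b q).length < α then 1 else 0 := by
  rw [dickWeight_eq, dickWeight_eq, digitPositions_mul_add hb q hr, List.reverse_append,
    List.take_append, List.map_append, List.sum_append, ← List.map_reverse, ← List.map_take,
    List.sum_map_add_one (List.map _ _)]
  congr 1
  · simp [min_comm]
  · by_cases h0 : r = 0
    · simp [h0]
    · by_cases h : (digitPositions b q).length < α
      · obtain ⟨m, hm⟩ : ∃ m, α - (digitPositions b q).length = m + 1 :=
          ⟨α - (digitPositions b q).length - 1, by omega⟩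
        simp [h0, h, hm]
      · simp [h0, h, Nat.sub_eq_zero_of_le (not_lt.mp h)]

/-- `x ^ μ_α(k)` restricted to those `k` for which `min(α, v) = j`, where `v` is the number of
nonzero digits of `k`. -/
noncomputable def dickTerm (b α : ℕ) (x : ℝ) (j k : ℕ) : ℝ :=
  if min (digitPositions b k).length α = j then x ^ dickWeight b α k else 0

theorem dickTerm_nonneg (b α : ℕ) {x : ℝ} (hx : 0 ≤ x) (j k : ℕ) : 0 ≤ dickTerm b α x j k := by
  unfold dickTerm
  split_ifs <;> positivity

theorem sum_dickTerm (b α : ℕ) (x : ℝ) (k : ℕ) :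
    ∑ j ∈ Finset.range (α + 1), dickTerm b α x j k = x ^ dickWeight b α k := by
  simp [dickTerm, Finset.sum_ite_eq]

theorem sum_dickTerm_mul_add_zero {b : ℕ} (hb : 2 ≤ b) {α : ℕ} (hα : 0 < α) (x : ℝ) (q : ℕ) :
    ∑ r ∈ Finset.range b, dickTerm b α x 0 (b * q + r) = dickTerm b α x 0 q := by
  rw [Finset.sum_eq_single_of_mem 0 (Finset.mem_range.2 (by omega))]
  · have h1 := length_digitPositions_mul_add hb q (r := 0) (by omega)
    have h2 := dickWeight_mul_add hb α q (r := 0) (by omega)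
    simp only [dickTerm, h1, h2]
    by_cases h : (digitPositions b q).length = 0
    · simp [h]
    · have : min (digitPositions b q).length α ≠ 0 := by omega
      simp [this]
  · intro r hr h0
    rw [dickTerm, length_digitPositions_mul_add hb q (Finset.mem_range.1 hr), if_neg]
    simp only [h0, if_false]
    omega

theorem sum_dickTerm_mul_add_succ {b : ℕ} (hb : 2 ≤ b) {α j : ℕ} (hj : j + 1 ≤ α) (x : ℝ)
    (q : ℕ) :
    ∑ r ∈ Finset.range b, dickTerm b α x (j + 1) (b * q + r) =
      (if j + 1 = α then (b : ℝ) else 1) * x ^ (j + 1) * dickTerm b α x (j + 1) q +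
        ((b : ℝ) - 1) * x ^ (j + 1) * dickTerm b α x j q := by
  have hterm : ∀ r ∈ Finset.range b, dickTerm b α x (j + 1) (b * q + r) =
      if r = 0 then x ^ (j + 1) * dickTerm b α x (j + 1) q
      else (if j + 1 = α then 1 else 0) * x ^ (j + 1) * dickTerm b α x (j + 1) q +
        x ^ (j + 1) * dickTerm b α x j q := by
    intro r hr
    have hr := Finset.mem_range.1 hr
    simp only [dickTerm, length_digitPositions_mul_add hb q hr, dickWeight_mul_add hb α q hr]
    generalize (digitPositions b q).length = v
    generalize dickWeight b α q = μ
    by_cases h0 : r = 0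
    · by_cases h : min v α = j + 1
      · simp [h0, h, pow_add, mul_comm]
      · simp [h0, h]
    · rcases lt_trichotomy v j with hv | rfl | hv
      · have h1 : min (v + 1) α ≠ j + 1 := by omega
        have h2 : min v α ≠ j + 1 := by omega
        have h3 : min v α ≠ j := by omega
        simp [h0, h1, h2, h3]
      · have h1 : min (v + 1) α = v + 1 := by omega
        have h3 : min v α = v := by omega
        have h4 : v < α := by omega
        simp only [h0, h1, h3, h4, ne_eq, not_false_eq_true, and_self, if_true, if_false]
        have h2 : v ≠ v + 1 := by omega
        simp only [h2, if_false, mul_zero, zero_add]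
        ring
      · have h3 : min v α ≠ j := by omega
        by_cases ha : j + 1 = α
        · have h1 : min (v + 1) α = j + 1 := by omega
          have h2 : min v α = j + 1 := by omega
          have h4 : ¬ v < α := by omega
          subst ha
          have h5 : j + 1 ≠ j := by omega
          simp only [h0, h1, h2, h5, h4, if_true, if_false, and_false, mul_zero, add_zero,
            one_mul]
          rw [pow_add, mul_comm]
        · have h1 : min (v + 1) α ≠ j + 1 := by omega
          simp [h0, h1, h3, ha]
  rw [Finset.sum_congr rfl hterm]
  obtain ⟨c, rfl⟩ : ∃ c, b = c + 1 := ⟨b - 1, by omega⟩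
  rw [Finset.sum_range_succ']
  simp only [Nat.add_eq_zero_iff, one_ne_zero, and_false, if_false, if_true, Finset.sum_const,
    Finset.card_range, nsmul_eq_mul]
  push_cast
  split_ifs <;> ring

theorem Finset.sum_range_mul_eq {M : Type*} [AddCommMonoid M] (f : ℕ → M) (b N : ℕ) :
    ∑ k ∈ Finset.range (b * N), f k =
      ∑ q ∈ Finset.range N, ∑ r ∈ Finset.range b, f (b * q + r) := by
  induction N with
  | zero => simp
  | succ N ih => rw [mul_add_one, Finset.sum_range_add, ih, Finset.sum_range_succ]

theorem tendsto_of_monotone_of_affine_recurrence {a d : ℕ → ℝ} {c D : ℝ} (hc : c < 1)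
    (ha : Monotone a) (hrec : ∀ n, a (n + 1) = c * a n + d n) (hd : Tendsto d atTop (𝓝 D)) :
    Tendsto a atTop (𝓝 (D / (1 - c))) := by
  have hc' : 0 < 1 - c := sub_pos.2 hc
  obtain ⟨B, hB⟩ := hd.bddAbove_range
  have hbdd : BddAbove (Set.range a) := by
    refine ⟨B / (1 - c), ?_⟩
    rintro _ ⟨n, rfl⟩
    rw [le_div_iff₀ hc']
    have h1 := ha n.le_succ
    have h2 : d n ≤ B := hB ⟨n, rfl⟩
    rw [Nat.succ_eq_add_one, hrec] at h1
    linarith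
  have hlim := tendsto_atTop_ciSup ha hbdd
  have hlim' := (tendsto_add_atTop_iff_nat 1).2 hlim
  simp only [hrec] at hlim'
  have heq := tendsto_nhds_unique hlim' ((hlim.const_mul c).add hd)
  convert hlim using 2
  rw [div_eq_iff hc'.ne']
  linarith

theorem monotone_sum_range_pow_dickTerm {b : ℕ} (hb : 2 ≤ b) (α : ℕ) {x : ℝ} (hx : 0 ≤ x)
    (j : ℕ) : Monotone fun n => ∑ k ∈ Finset.range (b ^ n), dickTerm b α x j k := by
  intro m n hmn
  refine Finset.sum_le_sum_of_subset_of_nonneg ?_ fun k _ _ => dickTerm_nonneg b α hx j k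
  exact Finset.range_subset_range.2 (Nat.pow_le_pow_right (by omega) hmn)

theorem tendsto_sum_dickTerm_succ {b : ℕ} (hb : 2 ≤ b) {α j : ℕ} (hj : j + 1 ≤ α) {x L : ℝ}
    (hx : 0 ≤ x) (hc : (if j + 1 = α then (b : ℝ) else 1) * x ^ (j + 1) < 1)
    (hL : Tendsto (fun n => ∑ k ∈ Finset.range (b ^ n), dickTerm b α x j k) atTop (𝓝 L)) :
    Tendsto (fun n => ∑ k ∈ Finset.range (b ^ n), dickTerm b α x (j + 1) k) atTop
      (𝓝 (((b : ℝ) - 1) * x ^ (j + 1) * L /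
        (1 - (if j + 1 = α then (b : ℝ) else 1) * x ^ (j + 1)))) := by
  refine tendsto_of_monotone_of_affine_recurrence hc
    (monotone_sum_range_pow_dickTerm hb α hx (j + 1)) (fun n => ?_)
    (hL.const_mul (((b : ℝ) - 1) * x ^ (j + 1)))
  rw [pow_succ' b n, Finset.sum_range_mul_eq,
    Finset.sum_congr rfl fun q _ => sum_dickTerm_mul_add_succ hb hj x q,
    Finset.sum_add_distrib, ← Finset.mul_sum, ← Finset.mul_sum]

theorem sum_range_pow_dickTerm_zero {b : ℕ} (hb : 2 ≤ b) {α : ℕ} (hα : 0 < α) (x : ℝ) (n : ℕ) :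
    ∑ k ∈ Finset.range (b ^ n), dickTerm b α x 0 k = 1 := by
  induction n with
  | zero => simp [dickTerm, dickWeight_eq, digitPositions_zero]
  | succ n ih =>
    rw [pow_succ' b n, Finset.sum_range_mul_eq,
      Finset.sum_congr rfl fun q _ => sum_dickTerm_mul_add_zero hb hα x q, ih]

theorem tendsto_sum_dickTerm_of_lt {b : ℕ} (hb : 2 ≤ b) {α : ℕ} {x : ℝ} (hx : 0 < x)
    (hx1 : x < 1) {j : ℕ} (hj : j < α) :
    Tendsto (fun n => ∑ k ∈ Finset.range (b ^ n), dickTerm b α x j k) atTop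
      (𝓝 (∏ i ∈ Finset.Icc 1 j, ((b : ℝ) - 1) / ((x ^ i)⁻¹ - 1))) := by
  induction j with
  | zero => simp [sum_range_pow_dickTerm_zero hb hj x]
  | succ j ih =>
    have hpow : x ^ (j + 1) < 1 := pow_lt_one₀ hx.le hx1 (by omega)
    have h := tendsto_sum_dickTerm_succ hb hj.le hx.le
      (by rwa [if_neg hj.ne, one_mul]) (ih (by omega))
    convert h using 2
    have hp : 0 < x ^ (j + 1) := by positivity
    rw [Finset.prod_Icc_succ_top (by omega), if_neg hj.ne]
    generalize x ^ (j + 1) = y at *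
    have h1 : 1 - y ≠ 0 := by linarith
    rw [inv_eq_one_div, div_sub_one hp.ne', one_mul]
    field_simp

theorem hasSum_pow_dickWeight {b : ℕ} (hb : 2 ≤ b) {α : ℕ} (hα : 0 < α) {x : ℝ} (hx : 0 < x)
    (hx1 : x < 1) (hbx : b * x ^ α < 1) :
    HasSum (fun k : ℕ => x ^ dickWeight b α (k + 1))
      ((∑ τ ∈ Finset.Icc 1 (α - 1), ∏ i ∈ Finset.Icc 1 τ, ((b : ℝ) - 1) / ((x ^ i)⁻¹ - 1)) +
        (((x ^ α)⁻¹ - 1) / ((x ^ α)⁻¹ - b)) *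
          ∏ i ∈ Finset.Icc 1 α, ((b : ℝ) - 1) / ((x ^ i)⁻¹ - 1)) := by
  obtain ⟨a, rfl⟩ : ∃ a, α = a + 1 := ⟨α - 1, by omega⟩
  have htop := tendsto_sum_dickTerm_succ hb le_rfl hx.le (by rwa [if_pos rfl])
    (tendsto_sum_dickTerm_of_lt hb hx hx1 a.lt_succ_self)
  rw [if_pos rfl] at htop
  have htotal := (tendsto_finsetSum (Finset.range (a + 1)) fun j hj =>
    tendsto_sum_dickTerm_of_lt hb hx hx1 (Finset.mem_range.1 hj)).add htop
  simp only [← Finset.sum_range_succ (fun j => ∑ k ∈ Finset.range (b ^ _), dickTerm b (a + 1) x j k),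
    Finset.sum_comm (s := Finset.range (a + 1 + 1)), sum_dickTerm] at htotal
  have hmono : Monotone fun n => ∑ k ∈ Finset.range n, x ^ dickWeight b (a + 1) k :=
    fun m n hmn => Finset.sum_le_sum_of_subset_of_nonneg (Finset.range_subset_range.2 hmn)
      fun k _ _ => by positivity
  have hsum := (hasSum_iff_tendsto_nat_of_nonneg (fun k => by positivity) _).2
    ((tendsto_iff_tendsto_subseq_of_monotone hmono
      (tendsto_pow_atTop_atTop_of_one_lt (by omega : 1 < b))).2 htotal)
  rw [← hasSum_nat_add_iff' 1] at hsum
  refine Eq.subst (motive := HasSum _) (Eq.symm ?_) hsum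
  have hp : 0 < x ^ (a + 1) := by positivity
  have hp1 : x ^ (a + 1) < 1 := pow_lt_one₀ hx.le hx1 (by omega)
  rw [Finset.range_eq_Ico, Finset.sum_eq_sum_Ico_succ_bot (by omega), Finset.sum_range_one,
    Finset.prod_Icc_succ_top (by omega), add_tsub_cancel_right]
  have hI : Finset.Ico (0 + 1) (a + 1) = Finset.Icc 1 a := by
    ext
    simp only [Finset.mem_Ico, Finset.mem_Icc]
    omega
  rw [hI]
  simp only [dickWeight_eq, digitPositions_zero, List.reverse_nil, List.take_nil, List.map_nil,
    List.sum_nil, pow_zero, Finset.Icc_eq_empty_of_lt zero_lt_one, Finset.prod_empty]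
  generalize x ^ (a + 1) = y at *
  have h1 : 1 - y ≠ 0 := by linarith
  have h2 : 1 - b * y ≠ 0 := by linarith
  have e1 : y⁻¹ - 1 = (1 - y) / y := by field_simp
  have e2 : y⁻¹ - b = (1 - b * y) / y := by field_simp
  have e3 : (y⁻¹ - 1) / (y⁻¹ - b) *
      ((∏ i ∈ Finset.Icc 1 a, ((b : ℝ) - 1) / ((x ^ i)⁻¹ - 1)) * ((b - 1) / (y⁻¹ - 1))) =
      (b - 1) * y * (∏ i ∈ Finset.Icc 1 a, ((b : ℝ) - 1) / ((x ^ i)⁻¹ - 1)) / (1 - b * y) := by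
    rw [e1, e2]
    field_simp
  rw [e3]
  ring

/-- For an integer base `b ≥ 2`, smoothness `α ≥ 2` and `λ ∈ (1/α, 1]`, the sum
`∑_{k ≥ 1} b^{-λ μ_α(k)}` converges and equals
`A_{α,λ} = ∑_{τ=1}^{α-1} ∏_{i=1}^{τ} (b-1)/(b^{λi}-1)
  + ((b^{λα}-1)/(b^{λα}-b)) ∏_{i=1}^{α} (b-1)/(b^{λi}-1)`. -/
theorem stmt_15 (b α : ℕ) (hb : 2 ≤ b) (hα : 2 ≤ α)
    (l : ℝ) (hl : l ∈ Set.Ioc (1 / (α : ℝ)) 1) :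
    Summable (fun k : ℕ => (b : ℝ) ^ (-(l * (dickWeight b α (k + 1) : ℝ)))) ∧
    ∑' k : ℕ, (b : ℝ) ^ (-(l * (dickWeight b α (k + 1) : ℝ))) =
      (∑ τ ∈ Finset.Icc 1 (α - 1), ∏ i ∈ Finset.Icc 1 τ,
          ((b : ℝ) - 1) / ((b : ℝ) ^ (l * (i : ℝ)) - 1)) +
        (((b : ℝ) ^ (l * (α : ℝ)) - 1) / ((b : ℝ) ^ (l * (α : ℝ)) - b)) *
          ∏ i ∈ Finset.Icc 1 α, ((b : ℝ) - 1) / ((b : ℝ) ^ (l * (i : ℝ)) - 1) := by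
  have hb1 : (1 : ℝ) < b := by exact_mod_cast (by omega : 1 < b)
  have hb0 : (0 : ℝ) < b := by linarith
  have hα0 : (0 : ℝ) < α := by exact_mod_cast (by omega : 0 < α)
  have hl1 : 1 < l * α := (div_lt_iff₀ hα0).1 hl.1
  have hl0 : 0 < l := lt_trans (by positivity) hl.1
  have hpow (n : ℕ) : (b : ℝ) ^ (-(l * (n : ℝ))) = ((b : ℝ) ^ (-l)) ^ n := by
    rw [← neg_mul, Real.rpow_mul_natCast hb0.le]
  have hinv (n : ℕ) : (b : ℝ) ^ (l * (n : ℝ)) = (((b : ℝ) ^ (-l)) ^ n)⁻¹ := by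
    rw [← hpow, Real.rpow_neg hb0.le, inv_inv]
  have hbx : (b : ℝ) * ((b : ℝ) ^ (-l)) ^ α < 1 := by
    rw [← hpow]
    nth_rewrite 1 [← Real.rpow_one (b : ℝ)]
    rw [← Real.rpow_add hb0]
    exact Real.rpow_lt_one_of_one_lt_of_neg hb1 (by linarith)
  have h := hasSum_pow_dickWeight hb (by omega) (Real.rpow_pos_of_pos hb0 (-l))
    (Real.rpow_lt_one_of_one_lt_of_neg hb1 (neg_lt_zero.2 hl0)) hbx
  simp only [hpow, hinv]
  exact ⟨h.summable, h.tsum_eq⟩
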